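/- arXiv:1012.4154 — 15 statements merged into one kernel-verified Lean document; each statement's English description precedes it below -/
import Mathlib

section
/- For every object x of ℳ, the object (x, θ_{I x} : I x ⟶ J(N(I x))) is a terminal object of the costructured-arrow category I ↓ J(N(I x)) if and only if the unit component η_x : x ⟶ M(J(N(I x))) of the composite adjunction is an isomorphism. -/
open CategoryTheory CategoryTheory.Limits

/-- Given an adjunction `F ⊣ G`, an object `(x, f : F x ⟶ c)` of `F ↓ c` is terminal if and only
if the transpose of `f` is an isomorphism. -/
theorem CategoryTheory.Adjunction.nonempty_isTerminal_mk_iff_isIso_homEquiv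
    {A B : Type*} [Category A] [Category B] {F : A ⥤ B} {G : B ⥤ A} (adj : F ⊣ G)
    {x : A} {c : B} (f : F.obj x ⟶ c) :
    Nonempty (IsTerminal (CostructuredArrow.mk f)) ↔ IsIso (adj.homEquiv x c f) := by
  let g : CostructuredArrow.mk f ⟶ CostructuredArrow.mk (adj.counit.app c) :=
    CostructuredArrow.homMk (adj.homEquiv x c f) (by simp [Adjunction.homEquiv_unit])
  have hT := mkTerminalOfRightAdjoint _ adj c
  constructor
  · rintro ⟨h⟩
    have : IsIso g := isIso_of_isTerminal h hT g
    exact inferInstanceAs (IsIso ((CostructuredArrow.proj F c).map g))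
  · intro h
    have : IsIso ((CostructuredArrow.proj F c).map g) := h
    have : IsIso g := isIso_of_reflects_iso g (CostructuredArrow.proj F c)
    exact ⟨hT.ofIso (asIso g).symm⟩

/-- For an object `x` of `ℳ`, `(x, θ_{I x})` is terminal in the costructured-arrow
category `I ↓ J(N(I x))` if and only if the unit component
`η_x = M(θ_{I x}) ∘ σ_x` of the composite adjunction `(I ⋙ N) ⊣ (J ⋙ M)` is an
isomorphism. -/
theorem isTerminal_unit_iff_isIso_compUnit
    {C M' N' : Type*} [Category C] [Category M'] [Category N']
    (I : M' ⥤ C) (M : C ⥤ M') (N : C ⥤ N') (J : N' ⥤ C)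
    (adjN : N ⊣ J) (adjI : I ⊣ M) (x : M') :
    Nonempty (IsTerminal (CostructuredArrow.mk (adjN.unit.app (I.obj x)) :
        CostructuredArrow I (J.obj (N.obj (I.obj x))))) ↔
      IsIso (adjI.unit.app x ≫ M.map (adjN.unit.app (I.obj x))) := by
  rw [adjI.nonempty_isTerminal_mk_iff_isIso_homEquiv, Adjunction.homEquiv_unit]
end

section
/- The composite functor I ⋙ N : ℳ ⥤ 𝒩 is full and faithful if and only if for every object x of ℳ the object (x, θ_{I x} : I x ⟶ J(N(I x))) is a terminal object of the costructured-arrow category I ↓ J(N(I x)). -/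
open CategoryTheory CategoryTheory.Limits

/-- A costructured arrow `F.obj a ⟶ c` is terminal iff every `F.obj b ⟶ c` factors through it
along a unique morphism `b ⟶ a`. -/
theorem CategoryTheory.CostructuredArrow.nonempty_isTerminal_mk_iff
    {A C : Type*} [Category A] [Category C] {F : A ⥤ C} {a : A} {c : C} (h : F.obj a ⟶ c) :
    Nonempty (IsTerminal (CostructuredArrow.mk h)) ↔
      ∀ b : A, Function.Bijective fun g : b ⟶ a ↦ F.map g ≫ h := by
  constructor
  · rintro ⟨t⟩ b
    refine ⟨fun g₁ g₂ e ↦ ?_, fun f ↦ ?_⟩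
    · exact congrArg CommaMorphism.left (t.hom_ext
        (CostructuredArrow.homMk g₁ : CostructuredArrow.mk (F.map g₁ ≫ h) ⟶
          CostructuredArrow.mk h)
        (CostructuredArrow.homMk g₂ e.symm))
    · exact ⟨(t.from (CostructuredArrow.mk f)).left, CostructuredArrow.w _⟩
  · intro hb
    choose g hg using fun X : CostructuredArrow F c ↦ (hb X.left).2 X.hom
    refine ⟨IsTerminal.ofUniqueHom (fun X ↦ CostructuredArrow.homMk (g X) (hg X)) fun X m ↦ ?_⟩
    ext
    exact (hb X.left).1 ((CostructuredArrow.w m).trans (hg X).symm)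

/-- Postcomposing with the unit of an adjunction corresponds to applying the left adjoint. -/
theorem CategoryTheory.Adjunction.bijective_comp_unit_iff
    {A C D : Type*} [Category A] [Category C] [Category D] {L : C ⥤ D} {R : D ⥤ C}
    (adj : L ⊣ R) (F : A ⥤ C) (a b : A) :
    (Function.Bijective fun g : b ⟶ a ↦ F.map g ≫ adj.unit.app (F.obj a)) ↔
      Function.Bijective ((F ⋙ L).map : (b ⟶ a) → _) := by
  rw [← Equiv.comp_bijective _ (adj.homEquiv (F.obj b) (L.obj (F.obj a)))]
  refine iff_of_eq (congrArg _ (funext fun g ↦ ?_))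
  simp [Adjunction.homEquiv_unit]

/-- The composite functor `I ⋙ N : ℳ ⥤ 𝒩` is full and faithful if and only if for every
object `x` of `ℳ` the object `(x, θ_{I x})` is terminal in the costructured-arrow
category `I ↓ J(N(I x))`. -/
theorem comp_full_faithful_iff_isTerminal
    {C M' N' : Type*} [Category C] [Category M'] [Category N']
    (I : M' ⥤ C) (M : C ⥤ M') (N : C ⥤ N') (J : N' ⥤ C)
    (adjN : N ⊣ J) (adjI : I ⊣ M) :
    ((I ⋙ N).Full ∧ (I ⋙ N).Faithful) ↔
      ∀ x : M', Nonempty (IsTerminal (CostructuredArrow.mk (adjN.unit.app (I.obj x)) :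
        CostructuredArrow I (J.obj (N.obj (I.obj x))))) := by
  simp only [CostructuredArrow.nonempty_isTerminal_mk_iff, adjN.bijective_comp_unit_iff I]
  constructor
  · rintro ⟨_, _⟩ x y
    exact ⟨(I ⋙ N).map_injective, (I ⋙ N).map_surjective⟩
  · intro h
    exact ⟨⟨fun {y x} ↦ (h x y).2⟩, ⟨fun {y x} ↦ @(h x y).1⟩⟩
end

section
/- For every object y of 𝒩, the object (y, ψ_{J y} : I(M(J y)) ⟶ J y) is an initial object of the structured-arrow category I(M(J y)) ↓ J if and only if the counit component ε_y : N(I(M(J y))) ⟶ y of the composite adjunction is an isomorphism. -/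
open CategoryTheory CategoryTheory.Limits

/-- For an adjunction `F ⊣ G`, a structured arrow `g : c ⟶ G y` is initial in `c ↓ G` if and only
if its transpose `F c ⟶ y` is an isomorphism. -/
theorem StructuredArrow.nonempty_isInitial_mk_iff_isIso_transpose
    {C D : Type*} [Category C] [Category D] {F : C ⥤ D} {G : D ⥤ C} (adj : F ⊣ G)
    {c : C} {y : D} (g : c ⟶ G.obj y) :
    Nonempty (IsInitial (StructuredArrow.mk g : StructuredArrow c G)) ↔
      IsIso (F.map g ≫ adj.counit.app y) := by
  let f : (StructuredArrow.mk (adj.unit.app c) : StructuredArrow c G) ⟶ StructuredArrow.mk g :=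
    StructuredArrow.homMk (F.map g ≫ adj.counit.app y) (by simp)
  have hu := mkInitialOfLeftAdjoint G adj c
  constructor
  · rintro ⟨hg⟩
    have : IsIso f := isIso_of_isInitial hu hg f
    exact inferInstanceAs (IsIso ((StructuredArrow.proj c G).map f))
  · intro h
    exact ⟨hu.ofIso (StructuredArrow.isoMk (asIso (F.map g ≫ adj.counit.app y)) (by simp))⟩

/-- For an object `y` of `𝒩`, `(y, ψ_{J y})` is initial in the structured-arrow category
`I(M(J y)) ↓ J` if and only if the counit component `ε_y = ρ_y ∘ N(ψ_{J y})` of the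
composite adjunction `(I ⋙ N) ⊣ (J ⋙ M)` is an isomorphism. -/
theorem isInitial_counit_iff_isIso_compCounit
    {C M' N' : Type*} [Category C] [Category M'] [Category N']
    (I : M' ⥤ C) (M : C ⥤ M') (N : C ⥤ N') (J : N' ⥤ C)
    (adjN : N ⊣ J) (adjI : I ⊣ M) (y : N') :
    Nonempty (IsInitial (StructuredArrow.mk (adjI.counit.app (J.obj y)) :
        StructuredArrow (I.obj (M.obj (J.obj y))) J)) ↔
      IsIso (N.map (adjI.counit.app (J.obj y)) ≫ adjN.counit.app y) := by
  exact StructuredArrow.nonempty_isInitial_mk_iff_isIso_transpose adjN _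
end

section
/- The composite functor J ⋙ M : 𝒩 ⥤ ℳ is full and faithful if and only if for every object y of 𝒩 the object (y, ψ_{J y} : I(M(J y)) ⟶ J y) is an initial object of the structured-arrow category I(M(J y)) ↓ J. -/
open CategoryTheory CategoryTheory.Limits

/-- Under the adjunction `I ⊣ M`, the transpose of `M.map k` is precomposition of `k` with the
counit. -/
theorem CategoryTheory.Adjunction.homEquiv_symm_map_eq_counit_comp
    {C D : Type*} [Category C] [Category D] {I : D ⥤ C} {M : C ⥤ D} (adj : I ⊣ M)
    {X Y : C} (k : X ⟶ Y) :
    (adj.homEquiv (M.obj X) Y).symm (M.map k) = adj.counit.app X ≫ k := by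
  simp [Adjunction.homEquiv_counit]

/-- The composite functor `J ⋙ M : 𝒩 ⥤ ℳ` is full and faithful if and only if for every
object `y` of `𝒩` the object `(y, ψ_{J y})` is initial in the structured-arrow category
`I(M(J y)) ↓ J`. -/
theorem comp_full_faithful_iff_isInitial
    {C M' N' : Type*} [Category C] [Category M'] [Category N']
    (I : M' ⥤ C) (M : C ⥤ M') (N : C ⥤ N') (J : N' ⥤ C)
    (adjN : N ⊣ J) (adjI : I ⊣ M) :
    ((J ⋙ M).Full ∧ (J ⋙ M).Faithful) ↔
      ∀ y : N', Nonempty (IsInitial (StructuredArrow.mk (adjI.counit.app (J.obj y)) :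
        StructuredArrow (I.obj (M.obj (J.obj y))) J)) := by
  constructor
  · rintro ⟨hfull, hfaithful⟩ y
    have key (Z : StructuredArrow (I.obj (M.obj (J.obj y))) J) :
        ∃ f : y ⟶ Z.right, adjI.counit.app (J.obj y) ≫ J.map f = Z.hom := by
      obtain ⟨f, hf⟩ := (J ⋙ M).map_surjective (adjI.homEquiv _ _ Z.hom)
      refine ⟨f, ?_⟩
      rw [← adjI.homEquiv_symm_map_eq_counit_comp, Equiv.symm_apply_eq]
      exact hf
    choose f hf using key
    refine ⟨IsInitial.ofUniqueHom (fun Z => StructuredArrow.homMk (f Z) (hf Z)) fun Z m => ?_⟩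
    ext
    apply (J ⋙ M).map_injective
    apply (adjI.homEquiv _ _).symm.injective
    simp only [Functor.comp_map]
    erw [adjI.homEquiv_symm_map_eq_counit_comp, adjI.homEquiv_symm_map_eq_counit_comp]
    exact (StructuredArrow.w m).trans (hf Z).symm
  · intro h
    refine ⟨⟨fun {y z} g => ?_⟩, ⟨fun {y z} f g hfg => ?_⟩⟩
    · obtain ⟨hy⟩ := h y
      let m := hy.to (StructuredArrow.mk ((adjI.homEquiv _ _).symm g))
      refine ⟨m.right, (adjI.homEquiv _ _).symm.injective ?_⟩
      exact (adjI.homEquiv_symm_map_eq_counit_comp _).trans (StructuredArrow.w m)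
    · obtain ⟨hy⟩ := h y
      have w : adjI.counit.app (J.obj y) ≫ J.map f = adjI.counit.app (J.obj y) ≫ J.map g := by
        rw [← adjI.homEquiv_symm_map_eq_counit_comp, ← adjI.homEquiv_symm_map_eq_counit_comp]
        exact congrArg _ hfg
      let Z := StructuredArrow.mk (adjI.counit.app (J.obj y) ≫ J.map g)
      exact congrArg CommaMorphism.right
        (hy.hom_ext (StructuredArrow.homMk f w : _ ⟶ Z) (StructuredArrow.homMk g rfl))
end

section
/- The composite adjunction (I ⋙ N) ⊣ (J ⋙ M) is an adjoint equivalence (i.e., its unit η and counit ε are both natural isomorphisms) if and only if both of the following hold: (F) for every object x of ℳ, the object (x, θ_{I x}) is terminal in the costructured-arrow category I ↓ J(N(I x)); and (I) for every object y of 𝒩, the object (y, ψ_{J y}) is initial in the structured-arrow category I(M(J y)) ↓ J. -/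
open CategoryTheory CategoryTheory.Limits

/-- Given `I ⊣ M`, the object `(x, f)` of `I ↓ c` is terminal iff the transpose of `f` is an
isomorphism. -/
theorem CategoryTheory.Adjunction.nonempty_isTerminal_mk_iff
    {C D : Type*} [Category C] [Category D] {I : D ⥤ C} {M : C ⥤ D} (adj : I ⊣ M)
    {x : D} {c : C} (f : I.obj x ⟶ c) :
    Nonempty (IsTerminal (CostructuredArrow.mk f : CostructuredArrow I c)) ↔
      IsIso (adj.homEquiv x c f) := by
  let φ : CostructuredArrow.mk f ⟶ CostructuredArrow.mk (adj.counit.app c) :=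
    CostructuredArrow.homMk (adj.homEquiv x c f) (by simp [Adjunction.homEquiv_unit])
  have hT := mkTerminalOfRightAdjoint M adj c
  constructor
  · rintro ⟨h⟩
    have : IsIso φ := isIso_of_isTerminal h hT φ
    exact inferInstanceAs (IsIso ((CostructuredArrow.proj I c).map φ))
  · intro h
    have : IsIso ((CostructuredArrow.proj I c).map φ) := h
    have : IsIso φ := isIso_of_reflects_iso φ (CostructuredArrow.proj I c)
    exact ⟨hT.ofIso (asIso φ).symm⟩

/-- Given `N ⊣ J`, the object `(y, g)` of `c ↓ J` is initial iff the transpose of `g` is an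
isomorphism. -/
theorem CategoryTheory.Adjunction.nonempty_isInitial_mk_iff
    {C D : Type*} [Category C] [Category D] {N : C ⥤ D} {J : D ⥤ C} (adj : N ⊣ J)
    {c : C} {y : D} (g : c ⟶ J.obj y) :
    Nonempty (IsInitial (StructuredArrow.mk g : StructuredArrow c J)) ↔
      IsIso ((adj.homEquiv c y).symm g) := by
  let φ : (StructuredArrow.mk (adj.unit.app c) : StructuredArrow c J) ⟶ StructuredArrow.mk g :=
    StructuredArrow.homMk ((adj.homEquiv c y).symm g) (by simp [Adjunction.homEquiv_counit])
  have hI := mkInitialOfLeftAdjoint J adj c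
  constructor
  · rintro ⟨h⟩
    have : IsIso φ := isIso_of_isInitial hI h φ
    exact inferInstanceAs (IsIso ((StructuredArrow.proj c J).map φ))
  · intro h
    have : IsIso ((StructuredArrow.proj c J).map φ) := h
    have : IsIso φ := isIso_of_reflects_iso φ (StructuredArrow.proj c J)
    exact ⟨hI.ofIso (asIso φ)⟩

/-- The composite adjunction `(I ⋙ N) ⊣ (J ⋙ M)` is an adjoint equivalence (its unit
and counit are natural isomorphisms) if and only if: (F) for every `x` in `ℳ`,
`(x, θ_{I x})` is terminal in `I ↓ J(N(I x))`, and (I) for every `y` in `𝒩`,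
`(y, ψ_{J y})` is initial in `I(M(J y)) ↓ J`. -/
theorem comp_adjoint_equivalence_iff
    {C M' N' : Type*} [Category C] [Category M'] [Category N']
    (I : M' ⥤ C) (M : C ⥤ M') (N : C ⥤ N') (J : N' ⥤ C)
    (adjN : N ⊣ J) (adjI : I ⊣ M) :
    (IsIso (adjI.comp adjN).unit ∧ IsIso (adjI.comp adjN).counit) ↔
      ((∀ x : M', Nonempty (IsTerminal (CostructuredArrow.mk (adjN.unit.app (I.obj x)) :
          CostructuredArrow I (J.obj (N.obj (I.obj x)))))) ∧
        (∀ y : N', Nonempty (IsInitial (StructuredArrow.mk (adjI.counit.app (J.obj y)) :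
          StructuredArrow (I.obj (M.obj (J.obj y))) J)))) := by
  simp only [adjI.nonempty_isTerminal_mk_iff, adjN.nonempty_isInitial_mk_iff,
    NatTrans.isIso_iff_isIso_app, Adjunction.homEquiv_unit, Adjunction.homEquiv_counit,
    Adjunction.comp_unit_app, Adjunction.comp_counit_app]
end

section
/- For every object x of 𝒞, the object (N x, θ_x ∘ ψ_x : I(M x) ⟶ J(N x)) is an initial object of the structured-arrow category I(M x) ↓ J if and only if N(ψ_x) : N(I(M x)) ⟶ N x is an isomorphism. -/
open CategoryTheory CategoryTheory.Limits

/-- For an adjunction `F ⊣ G` and a morphism `f : c ⟶ d`, the object `(F d, f ≫ η_d)` is initial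
in `c ↓ G` if and only if `F f` is an isomorphism. -/
theorem CategoryTheory.Adjunction.isInitial_mk_comp_unit_iff_isIso_map
    {C D : Type*} [Category C] [Category D] {F : C ⥤ D} {G : D ⥤ C} (adj : F ⊣ G)
    {c d : C} (f : c ⟶ d) :
    Nonempty (IsInitial (StructuredArrow.mk (f ≫ adj.unit.app d) : StructuredArrow c G)) ↔
      IsIso (F.map f) := by
  let φ : (StructuredArrow.mk (adj.unit.app c) : StructuredArrow c G) ⟶
      StructuredArrow.mk (f ≫ adj.unit.app d) :=
    StructuredArrow.homMk (F.map f) (adj.unit.naturality f).symm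
  have hc := mkInitialOfLeftAdjoint G adj c
  constructor
  · rintro ⟨h⟩
    have : IsIso φ := by
      rw [hc.hom_ext φ (hc.uniqueUpToIso h).hom]
      infer_instance
    exact inferInstanceAs (IsIso ((StructuredArrow.proj c G).map φ))
  · intro _
    exact ⟨hc.ofIso (StructuredArrow.isoMk (asIso (F.map f)) (adj.unit.naturality f).symm)⟩

/-- For every object `x` of `𝒞`, the object `(N x, θ_x ∘ ψ_x : I(M x) ⟶ J(N x))` is
initial in the structured-arrow category `I(M x) ↓ J` if and only if
`N(ψ_x) : N(I(M x)) ⟶ N x` is an isomorphism. -/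
theorem isInitial_comp_iff_isIso_map_counit
    {C M' N' : Type*} [Category C] [Category M'] [Category N']
    (I : M' ⥤ C) (M : C ⥤ M') (N : C ⥤ N') (J : N' ⥤ C)
    (adjN : N ⊣ J) (adjI : I ⊣ M) (x : C) :
    Nonempty (IsInitial (StructuredArrow.mk (adjI.counit.app x ≫ adjN.unit.app x) :
        StructuredArrow (I.obj (M.obj x)) J)) ↔
      IsIso (N.map (adjI.counit.app x)) :=
  adjN.isInitial_mk_comp_unit_iff_isIso_map (adjI.counit.app x)
end

section
/- For every object x of 𝒞, the object (M x, θ_x ∘ ψ_x : I(M x) ⟶ J(N x)) is a terminal object of the costructured-arrow category I ↓ J(N x) if and only if M(θ_x) : M x ⟶ M(J(N x)) is an isomorphism. -/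
open CategoryTheory CategoryTheory.Limits

/-- The canonical morphism from `ε_A ≫ f` to the counit at `B`, induced by `f : A ⟶ B`. -/
abbrev CategoryTheory.Adjunction.costructuredArrowHom {C D : Type*} [Category C] [Category D]
    {F : C ⥤ D} {G : D ⥤ C} (adj : F ⊣ G) {A B : D} (f : A ⟶ B) :
    CostructuredArrow.mk (S := F) (adj.counit.app A ≫ f) ⟶
      CostructuredArrow.mk (adj.counit.app B) :=
  CostructuredArrow.homMk (G.map f) (adj.counit_naturality f)

/-- Composing the counit with `f` gives a terminal costructured arrow if and only if the right
adjoint sends `f` to an isomorphism. -/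
theorem CategoryTheory.Adjunction.nonempty_isTerminal_counit_comp_iff {C D : Type*} [Category C]
    [Category D] {F : C ⥤ D} {G : D ⥤ C} (adj : F ⊣ G) {A B : D} (f : A ⟶ B) :
    Nonempty (IsTerminal (CostructuredArrow.mk (S := F) (adj.counit.app A ≫ f))) ↔
      IsIso (G.map f) := by
  have hB := mkTerminalOfRightAdjoint G adj B
  constructor
  · rintro ⟨hA⟩
    have := isIso_of_isTerminal hA hB (adj.costructuredArrowHom f)
    exact inferInstanceAs
      (IsIso ((CostructuredArrow.proj F B).map (adj.costructuredArrowHom f)))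
  · intro hf
    have : IsIso ((CostructuredArrow.proj F B).map (adj.costructuredArrowHom f)) := hf
    have := isIso_of_reflects_iso (adj.costructuredArrowHom f) (CostructuredArrow.proj F B)
    exact ⟨hB.ofIso (asIso (adj.costructuredArrowHom f)).symm⟩

/-- For every object `x` of `𝒞`, the object `(M x, θ_x ∘ ψ_x : I(M x) ⟶ J(N x))` is
terminal in the costructured-arrow category `I ↓ J(N x)` if and only if
`M(θ_x) : M x ⟶ M(J(N x))` is an isomorphism. -/
theorem isTerminal_comp_iff_isIso_map_unit
    {C M' N' : Type*} [Category C] [Category M'] [Category N']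
    (I : M' ⥤ C) (M : C ⥤ M') (N : C ⥤ N') (J : N' ⥤ C)
    (adjN : N ⊣ J) (adjI : I ⊣ M) (x : C) :
    Nonempty (IsTerminal (CostructuredArrow.mk (adjI.counit.app x ≫ adjN.unit.app x) :
        CostructuredArrow I (J.obj (N.obj x)))) ↔
      IsIso (M.map (adjN.unit.app x)) :=
  adjI.nonempty_isTerminal_counit_comp_iff (adjN.unit.app x)
end

section
/- Assume that I and J are both full and faithful, that N(ψ_x) is an isomorphism for every object x of 𝒞, and that M(θ_x) is an isomorphism for every object x of 𝒞. Then the composite adjunction (I ⋙ N) ⊣ (J ⋙ M) is an adjoint equivalence, i.e., its unit η and counit ε are natural isomorphisms. -/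
open CategoryTheory CategoryTheory.Limits

/-- If `I` and `J` are full and faithful, `N(ψ_x)` is an isomorphism for every `x` in
`𝒞`, and `M(θ_x)` is an isomorphism for every `x` in `𝒞`, then the composite adjunction
`(I ⋙ N) ⊣ (J ⋙ M)` is an adjoint equivalence, i.e. its unit and counit are natural
isomorphisms. -/
theorem comp_adjoint_equivalence_of_isIso
    {C M' N' : Type*} [Category C] [Category M'] [Category N']
    (I : M' ⥤ C) (M : C ⥤ M') (N : C ⥤ N') (J : N' ⥤ C)
    (adjN : N ⊣ J) (adjI : I ⊣ M) [I.Full] [I.Faithful] [J.Full] [J.Faithful]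
    (hN : ∀ x : C, IsIso (N.map (adjI.counit.app x)))
    (hM : ∀ x : C, IsIso (M.map (adjN.unit.app x))) :
    IsIso (adjI.comp adjN).unit ∧ IsIso (adjI.comp adjN).counit := by
  constructor
  · have (x : M') : IsIso ((adjI.comp adjN).unit.app x) := by
      have := hM (I.obj x)
      rw [Adjunction.comp_unit_app]
      infer_instance
    exact NatIso.isIso_of_isIso_app _
  · have (y : N') : IsIso ((adjI.comp adjN).counit.app y) := by
      have := hN (J.obj y)
      rw [Adjunction.comp_counit_app]
      infer_instance
    exact NatIso.isIso_of_isIso_app _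
end

section
/- Assume the composite adjunction (I ⋙ N) ⊣ (J ⋙ M) is an adjoint equivalence (its unit η and counit ε are natural isomorphisms). Then M(θ_x) is an isomorphism for every object x of 𝒞 if and only if N(ψ_x) is an isomorphism for every object x of 𝒞. -/
open CategoryTheory CategoryTheory.Limits

namespace CategoryTheory.Adjunction

variable {C D E : Type*} [Category C] [Category D] [Category E]
  {I : D ⥤ C} {M : C ⥤ D} {N : C ⥤ E} {J : E ⥤ C}

/-- The transpose of `N(ψ_x)` under the composite adjunction is `M(θ_x)`. -/
lemma comp_unit_app_map_map_counit_app (adjI : I ⊣ M) (adjN : N ⊣ J) (x : C) :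
    (adjI.comp adjN).unit.app (M.obj x) ≫ (J ⋙ M).map (N.map (adjI.counit.app x)) =
      M.map (adjN.unit.app x) := by
  have h := adjN.unit.naturality (adjI.counit.app x)
  dsimp at h
  simp only [comp_unit_app, Functor.comp_map, Category.assoc, ← Functor.map_comp, ← h]
  simp

/-- The transpose of `M(θ_x)` under the composite adjunction is `N(ψ_x)`. -/
lemma map_map_unit_app_comp_counit_app (adjI : I ⊣ M) (adjN : N ⊣ J) (x : C) :
    (I ⋙ N).map (M.map (adjN.unit.app x)) ≫ (adjI.comp adjN).counit.app (N.obj x) =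
      N.map (adjI.counit.app x) := by
  have h := adjI.counit.naturality (adjN.unit.app x)
  dsimp at h
  simp [comp_counit_app, ← Functor.map_comp_assoc, h]

end CategoryTheory.Adjunction

/-- If the composite adjunction `(I ⋙ N) ⊣ (J ⋙ M)` is an adjoint equivalence (its unit
and counit are natural isomorphisms), then `M(θ_x)` is an isomorphism for every object
`x` of `𝒞` if and only if `N(ψ_x)` is an isomorphism for every object `x` of `𝒞`. -/
theorem isIso_map_unit_iff_isIso_map_counit_of_equivalence
    {C M' N' : Type*} [Category C] [Category M'] [Category N']
    (I : M' ⥤ C) (M : C ⥤ M') (N : C ⥤ N') (J : N' ⥤ C)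
    (adjN : N ⊣ J) (adjI : I ⊣ M)
    (hu : IsIso (adjI.comp adjN).unit) (hc : IsIso (adjI.comp adjN).counit) :
    (∀ x : C, IsIso (M.map (adjN.unit.app x))) ↔
      (∀ x : C, IsIso (N.map (adjI.counit.app x))) := by
  refine forall_congr' fun x => ⟨fun h => ?_, fun h => ?_⟩
  · rw [← adjI.map_map_unit_app_comp_counit_app adjN x]
    infer_instance
  · rw [← adjI.comp_unit_app_map_map_counit_app adjN x]
    infer_instance
end

section
/- Assume the composite adjunction (I ⋙ N) ⊣ (J ⋙ M) is an adjoint equivalence and that N(ψ_x) is an isomorphism for every object x of 𝒞. Then the functors I and J are both full and faithful (equivalently, the unit σ of I ⊣ M and the counit ρ of N ⊣ J are natural isomorphisms). -/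
open CategoryTheory CategoryTheory.Limits

/-- If the composite adjunction `(I ⋙ N) ⊣ (J ⋙ M)` is an adjoint equivalence and
`N(ψ_x)` is an isomorphism for every object `x` of `𝒞`, then `I` and `J` are both full
and faithful. -/
theorem full_faithful_of_equivalence_of_isIso
    {C M' N' : Type*} [Category C] [Category M'] [Category N']
    (I : M' ⥤ C) (M : C ⥤ M') (N : C ⥤ N') (J : N' ⥤ C)
    (adjN : N ⊣ J) (adjI : I ⊣ M)
    (hu : IsIso (adjI.comp adjN).unit) (hc : IsIso (adjI.comp adjN).counit)
    (hN : ∀ x : C, IsIso (N.map (adjI.counit.app x))) :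
    I.Full ∧ I.Faithful ∧ J.Full ∧ J.Faithful := by
  have hρ (y : N') : IsIso (adjN.counit.app y) := by
    have h : IsIso (N.map (adjI.counit.app (J.obj y)) ≫ adjN.counit.app y) := by
      simpa using (inferInstance : IsIso ((adjI.comp adjN).counit.app y))
    have := hN (J.obj y)
    exact IsIso.of_isIso_comp_left (N.map (adjI.counit.app (J.obj y))) _
  have hθ (x : C) : IsIso (N.map (adjN.unit.app x)) := by
    have := hρ (N.obj x)
    have h : IsIso (N.map (adjN.unit.app x) ≫ adjN.counit.app (N.obj x)) := by
      have e := adjN.left_triangle_components x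
      exact e ▸ (inferInstance : IsIso (𝟙 (N.obj x)))
    exact IsIso.of_isIso_comp_right _ (adjN.counit.app (N.obj x))
  have : (I ⋙ N).IsEquivalence := (adjI.comp adjN).toEquivalence.isEquivalence_functor
  have hMθ (x : C) : IsIso (M.map (adjN.unit.app x)) := by
    have h : IsIso (N.map (I.map (M.map (adjN.unit.app x))) ≫
        N.map (adjI.counit.app (J.obj (N.obj x)))) := by
      have := hN x
      have := hθ x
      have e := congrArg N.map (adjI.counit.naturality (adjN.unit.app x))
      simp only [Functor.map_comp, Functor.comp_map, Functor.id_map] at e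
      exact e ▸ IsIso.comp_isIso
    have := hN (J.obj (N.obj x))
    have : IsIso ((I ⋙ N).map (M.map (adjN.unit.app x))) :=
      IsIso.of_isIso_comp_right (N.map (I.map (M.map (adjN.unit.app x))))
        (N.map (adjI.counit.app (J.obj (N.obj x))))
    exact isIso_of_reflects_iso _ (I ⋙ N)
  have hσ (x : M') : IsIso (adjI.unit.app x) := by
    have h : IsIso (adjI.unit.app x ≫ M.map (adjN.unit.app (I.obj x))) := by
      simpa using (inferInstance : IsIso ((adjI.comp adjN).unit.app x))
    have := hMθ (I.obj x)
    exact IsIso.of_isIso_comp_right _ (M.map (adjN.unit.app (I.obj x)))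
  have : IsIso adjI.unit := NatIso.isIso_of_isIso_app _
  have : IsIso adjN.counit := NatIso.isIso_of_isIso_app _
  have hI := adjI.fullyFaithfulLOfIsIsoUnit
  have hJ := adjN.fullyFaithfulROfIsIsoCounit
  exact ⟨hI.full, hI.faithful, hJ.full, hJ.faithful⟩
end

section
/- Assume that for every object x of 𝒞 the object (N x, θ_x ∘ ψ_x : I(M x) ⟶ J(N x)) is an initial object of the structured-arrow category I(M x) ↓ J. Then the morphisms N(ψ_x) : N(I(M x)) ⟶ N x are the components of a natural isomorphism of functors M ⋙ I ⋙ N ≅ N from 𝒞 to 𝒩. -/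
open CategoryTheory CategoryTheory.Limits

/-- If for every object `x` of `𝒞` the object `(N x, θ_x ∘ ψ_x)` is initial in the
structured-arrow category `I(M x) ↓ J`, then the morphisms `N(ψ_x) : N(I(M x)) ⟶ N x`
are the components of a natural isomorphism `M ⋙ I ⋙ N ≅ N`. -/
theorem natIso_of_isInitial
    {C M' N' : Type*} [Category C] [Category M'] [Category N']
    (I : M' ⥤ C) (M : C ⥤ M') (N : C ⥤ N') (J : N' ⥤ C)
    (adjN : N ⊣ J) (adjI : I ⊣ M)
    (h : ∀ x : C, Nonempty (IsInitial
      (StructuredArrow.mk (adjI.counit.app x ≫ adjN.unit.app x) :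
        StructuredArrow (I.obj (M.obj x)) J))) :
    ∃ e : M ⋙ I ⋙ N ≅ N, ∀ x : C, e.hom.app x = N.map (adjI.counit.app x) := by
  have hiso (x : C) : IsIso (N.map (adjI.counit.app x)) := by
    obtain ⟨hx⟩ := h x
    let f : (StructuredArrow.mk (adjN.unit.app (I.obj (M.obj x))) :
          StructuredArrow (I.obj (M.obj x)) J) ⟶
        (StructuredArrow.mk (adjI.counit.app x ≫ adjN.unit.app x) :
          StructuredArrow (I.obj (M.obj x)) J) :=
      StructuredArrow.homMk (N.map (adjI.counit.app x))
        (adjN.unit.naturality (adjI.counit.app x)).symm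
    have : IsIso f := isIso_of_isInitial (mkInitialOfLeftAdjoint J adjN _) hx f
    exact inferInstanceAs (IsIso ((StructuredArrow.proj _ J).map f))
  refine ⟨NatIso.ofComponents (fun x => asIso (N.map (adjI.counit.app x))) fun g => ?_,
    fun _ => rfl⟩
  exact (Functor.whiskerRight adjI.counit N).naturality g
end

section
/- Assume I and J are full and faithful, the composite adjunction (I ⋙ N) ⊣ (J ⋙ M) is an adjoint equivalence, and for every object x of 𝒞 the object (N x, θ_x ∘ ψ_x) is an initial object of the structured-arrow category I(M x) ↓ J. Then there is a natural isomorphism of functors N ⋙ J ⋙ M ≅ M from 𝒞 to ℳ. -/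
open CategoryTheory CategoryTheory.Limits

/-- If `f ≫ adj.unit.app x` is initial in the category of arrows from `c` to the right adjoint,
then the left adjoint inverts `f`. -/
theorem isIso_leftAdjoint_map_of_isInitial
    {C D : Type*} [Category C] [Category D] {L : C ⥤ D} {R : D ⥤ C} (adj : L ⊣ R)
    {c x : C} (f : c ⟶ x)
    (hf : IsInitial (StructuredArrow.mk (f ≫ adj.unit.app x) : StructuredArrow c R)) :
    IsIso (L.map f) := by
  let g : (StructuredArrow.mk (adj.unit.app c) : StructuredArrow c R) ⟶
      StructuredArrow.mk (f ≫ adj.unit.app x) :=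
    StructuredArrow.homMk (L.map f) (by simp)
  have hg : IsIso g := isIso_of_isInitial (mkInitialOfLeftAdjoint R adj c) hf g
  exact inferInstanceAs (IsIso ((StructuredArrow.proj c R).map g))

/-- If `I` and `J` are full and faithful, the composite adjunction `(I ⋙ N) ⊣ (J ⋙ M)`
is an adjoint equivalence, and for every object `x` of `𝒞` the object `(N x, θ_x ∘ ψ_x)`
is initial in the structured-arrow category `I(M x) ↓ J`, then there is a natural
isomorphism `N ⋙ J ⋙ M ≅ M`. -/
theorem natIso_M_factor
    {C M' N' : Type*} [Category C] [Category M'] [Category N']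
    (I : M' ⥤ C) (M : C ⥤ M') (N : C ⥤ N') (J : N' ⥤ C)
    (adjN : N ⊣ J) (adjI : I ⊣ M) [I.Full] [I.Faithful] [J.Full] [J.Faithful]
    (hu : IsIso (adjI.comp adjN).unit) (hc : IsIso (adjI.comp adjN).counit)
    (h : ∀ x : C, Nonempty (IsInitial
      (StructuredArrow.mk (adjI.counit.app x ≫ adjN.unit.app x) :
        StructuredArrow (I.obj (M.obj x)) J))) :
    Nonempty (N ⋙ J ⋙ M ≅ M) := by
  have hN (x : C) : IsIso (N.map (adjI.counit.app x)) :=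
    isIso_leftAdjoint_map_of_isInitial adjN _ (h x).some
  let α : (M ⋙ I) ⋙ N ≅ N :=
    NatIso.ofComponents (fun x => asIso (N.map (adjI.counit.app x)))
      (fun f => by
        simp only [asIso_hom, Functor.comp_map, ← N.map_comp]
        exact congrArg N.map (adjI.counit.naturality f))
  exact ⟨(Functor.isoWhiskerRight α (J ⋙ M)).symm ≪≫
    (Functor.isoWhiskerLeft M (asIso (adjI.comp adjN).unit)).symm⟩
end

section
/- Assume I and J are full and faithful, the composite adjunction (I ⋙ N) ⊣ (J ⋙ M) is an adjoint equivalence, and for every object x of 𝒞 the object (N x, θ_x ∘ ψ_x) is an initial object of the structured-arrow category I(M x) ↓ J. Then the composite functor M ⋙ I ⋙ N : 𝒞 ⥤ 𝒩 is a left adjoint of J (that is, M ⋙ I ⋙ N is a reflector of 𝒞 in 𝒩). -/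
open CategoryTheory CategoryTheory.Limits

/-- If `I` and `J` are full and faithful, the composite adjunction `(I ⋙ N) ⊣ (J ⋙ M)`
is an adjoint equivalence, and for every object `x` of `𝒞` the object `(N x, θ_x ∘ ψ_x)`
is initial in the structured-arrow category `I(M x) ↓ J`, then `M ⋙ I ⋙ N` is a left
adjoint of `J` (a reflector of `𝒞` in `𝒩`). -/
theorem reflector_factor
    {C M' N' : Type*} [Category C] [Category M'] [Category N']
    (I : M' ⥤ C) (M : C ⥤ M') (N : C ⥤ N') (J : N' ⥤ C)
    (adjN : N ⊣ J) (adjI : I ⊣ M) [I.Full] [I.Faithful] [J.Full] [J.Faithful]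
    (hu : IsIso (adjI.comp adjN).unit) (hc : IsIso (adjI.comp adjN).counit)
    (h : ∀ x : C, Nonempty (IsInitial
      (StructuredArrow.mk (adjI.counit.app x ≫ adjN.unit.app x) :
        StructuredArrow (I.obj (M.obj x)) J))) :
    Nonempty ((M ⋙ I ⋙ N) ⊣ J) := by
  have hψ (x : C) : IsIso (N.map (adjI.counit.app x)) := by
    obtain ⟨hx⟩ := h x
    let f : (StructuredArrow.mk (adjN.unit.app (I.obj (M.obj x))) :
          StructuredArrow (I.obj (M.obj x)) J) ⟶
        StructuredArrow.mk (adjI.counit.app x ≫ adjN.unit.app x) :=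
      StructuredArrow.homMk (N.map (adjI.counit.app x))
        (adjN.unit.naturality (adjI.counit.app x)).symm
    have : IsIso f :=
      isIso_of_isInitial (mkInitialOfLeftAdjoint J adjN (I.obj (M.obj x))) hx f
    exact inferInstanceAs (IsIso ((StructuredArrow.proj _ J).map f))
  have : IsIso (Functor.whiskerRight adjI.counit N) := by
    have (x : C) : IsIso ((Functor.whiskerRight adjI.counit N).app x) := hψ x
    exact NatIso.isIso_of_isIso_app _
  exact ⟨adjN.ofNatIsoLeft (asIso (Functor.whiskerRight adjI.counit N)).symm⟩
end

section
/- Assume I and J are full and faithful, the composite adjunction (I ⋙ N) ⊣ (J ⋙ M) is an adjoint equivalence, and for every object x of 𝒞 the object (N x, θ_x ∘ ψ_x) is an initial object of the structured-arrow category I(M x) ↓ J. Then the composite functor N ⋙ J ⋙ M : 𝒞 ⥤ ℳ is a right adjoint of I (that is, N ⋙ J ⋙ M is a coreflector of 𝒞 in ℳ). -/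
open CategoryTheory CategoryTheory.Limits

/-- If `(N x, ψ ≫ θ)` is initial in the category of arrows from `I (M x)` to `J`, then `N` inverts
the counit of `I ⊣ M` at `x`. -/
lemma isIso_map_counit_app_of_isInitial
    {C M' N' : Type*} [Category C] [Category M'] [Category N']
    {I : M' ⥤ C} {M : C ⥤ M'} {N : C ⥤ N'} {J : N' ⥤ C} (adjN : N ⊣ J) (adjI : I ⊣ M) {x : C}
    (h : IsInitial
      (StructuredArrow.mk (adjI.counit.app x ≫ adjN.unit.app x) :
        StructuredArrow (I.obj (M.obj x)) J)) :
    IsIso (N.map (adjI.counit.app x)) := by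
  let e := (mkInitialOfLeftAdjoint J adjN (I.obj (M.obj x))).uniqueUpToIso h
  let f : (StructuredArrow.mk (adjN.unit.app (I.obj (M.obj x))) :
        StructuredArrow (I.obj (M.obj x)) J) ⟶
      StructuredArrow.mk (adjI.counit.app x ≫ adjN.unit.app x) :=
    StructuredArrow.homMk (N.map (adjI.counit.app x)) (adjN.unit.naturality _).symm
  have hf : f = e.hom := (mkInitialOfLeftAdjoint J adjN (I.obj (M.obj x))).hom_ext _ _
  have : IsIso f := hf ▸ inferInstance
  exact inferInstanceAs (IsIso ((StructuredArrow.proj _ J).map f))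

/-- If `I` and `J` are full and faithful, the composite adjunction `(I ⋙ N) ⊣ (J ⋙ M)`
is an adjoint equivalence, and for every object `x` of `𝒞` the object `(N x, θ_x ∘ ψ_x)`
is initial in the structured-arrow category `I(M x) ↓ J`, then `N ⋙ J ⋙ M` is a right
adjoint of `I` (a coreflector of `𝒞` in `ℳ`). -/
theorem coreflector_factor
    {C M' N' : Type*} [Category C] [Category M'] [Category N']
    (I : M' ⥤ C) (M : C ⥤ M') (N : C ⥤ N') (J : N' ⥤ C)
    (adjN : N ⊣ J) (adjI : I ⊣ M) [I.Full] [I.Faithful] [J.Full] [J.Faithful]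
    (hu : IsIso (adjI.comp adjN).unit) (hc : IsIso (adjI.comp adjN).counit)
    (h : ∀ x : C, Nonempty (IsInitial
      (StructuredArrow.mk (adjI.counit.app x ≫ adjN.unit.app x) :
        StructuredArrow (I.obj (M.obj x)) J))) :
    Nonempty (I ⊣ (N ⋙ J ⋙ M)) := by
  have hθ (x : C) : IsIso (M.map (adjN.unit.app x)) := by
    have hN := isIso_map_counit_app_of_isInitial adjN adjI (h x).some
    have hI : IsIso (M.map (adjN.unit.app (I.obj (M.obj x)))) := by
      have hcomp : IsIso (adjI.unit.app (M.obj x) ≫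
          M.map (adjN.unit.app (I.obj (M.obj x)))) := by
        have hcomp : IsIso ((adjI.comp adjN).unit.app (M.obj x)) := inferInstance
        rwa [Adjunction.comp_unit_app] at hcomp
      exact IsIso.of_isIso_comp_left (adjI.unit.app (M.obj x)) _
    have hM : IsIso (M.map (adjI.counit.app x)) := by
      have hcomp : IsIso (adjI.unit.app (M.obj x) ≫ M.map (adjI.counit.app x)) := by
        rw [adjI.right_triangle_components]
        exact IsIso.id (M.obj x)
      exact IsIso.of_isIso_comp_left (adjI.unit.app (M.obj x)) _
    have hcomp : IsIso (M.map (adjI.counit.app x) ≫ M.map (adjN.unit.app x)) := by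
      have hsq : M.map (adjI.counit.app x) ≫ M.map (adjN.unit.app x) =
          M.map (adjN.unit.app (I.obj (M.obj x))) ≫
            M.map (J.map (N.map (adjI.counit.app x))) :=
        (Functor.whiskerRight adjN.unit M).naturality (adjI.counit.app x)
      rw [hsq]
      infer_instance
    exact IsIso.of_isIso_comp_left (M.map (adjI.counit.app x)) _
  have : IsIso (Functor.whiskerRight adjN.unit M) :=
    have (x : C) : IsIso ((Functor.whiskerRight adjN.unit M).app x) := hθ x
    NatIso.isIso_of_isIso_app _
  exact ⟨adjI.ofNatIsoRight
    (M.leftUnitor.symm ≪≫ asIso (Functor.whiskerRight adjN.unit M) ≪≫ N.associator J M)⟩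
end

section
/- Assume I and J are full and faithful, the composite adjunction (I ⋙ N) ⊣ (J ⋙ M) is an adjoint equivalence, and for every object x of 𝒞 the object (N x, θ_x ∘ ψ_x) is an initial object of the structured-arrow category I(M x) ↓ J. Then the following are equivalent: (1) ψ_x : I(M x) ⟶ x is an epimorphism in 𝒞 for every object x; (2) the functor M is faithful; (3) the functor N is faithful; (4) θ_x : x ⟶ J(N x) is a monomorphism in 𝒞 for every object x. -/
open CategoryTheory CategoryTheory.Limits

/-- If `(d, c ⟶ c' ⟶ R (L c'))` is initial in `c ↓ R`, then `L` inverts `c ⟶ c'`. -/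
theorem isIso_map_of_isInitial_mk_comp_unit {C D : Type*} [Category C] [Category D]
    {L : C ⥤ D} {R : D ⥤ C} (adj : L ⊣ R) {c c' : C} (f : c ⟶ c')
    (hf : IsInitial (StructuredArrow.mk (f ≫ adj.unit.app c') : StructuredArrow c R)) :
    IsIso (L.map f) := by
  let k : (StructuredArrow.mk (Y := L.obj c) (adj.unit.app c) : StructuredArrow c R) ⟶
      (StructuredArrow.mk (f ≫ adj.unit.app c') : StructuredArrow c R) :=
    StructuredArrow.homMk (L.map f) (adj.unit.naturality f).symm
  have hk : IsIso k :=
    isIso_of_isInitial (mkInitialOfLeftAdjoint R adj c) hf k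
  exact inferInstanceAs (IsIso ((StructuredArrow.proj c R).map k))

/-- A right adjoint is faithful iff its counit is componentwise an epimorphism. -/
theorem forall_epi_counit_iff_faithful {C D : Type*} [Category C] [Category D]
    {L : C ⥤ D} {R : D ⥤ C} (adj : L ⊣ R) :
    (∀ x : D, Epi (adj.counit.app x)) ↔ R.Faithful :=
  ⟨fun _ => adj.faithful_R_of_epi_counit_app, fun _ _ => inferInstance⟩

/-- A left adjoint is faithful iff its unit is componentwise a monomorphism. -/
theorem faithful_iff_forall_mono_unit {C D : Type*} [Category C] [Category D]
    {L : C ⥤ D} {R : D ⥤ C} (adj : L ⊣ R) :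
    L.Faithful ↔ ∀ x : C, Mono (adj.unit.app x) :=
  ⟨fun _ _ => inferInstance, fun _ => adj.faithful_L_of_mono_unit_app⟩

/-- If `I` and `J` are full and faithful, the composite adjunction `(I ⋙ N) ⊣ (J ⋙ M)`
is an adjoint equivalence, and for every object `x` of `𝒞` the object `(N x, θ_x ∘ ψ_x)`
is initial in `I(M x) ↓ J`, then the following are equivalent: (1) every `ψ_x` is an
epimorphism; (2) `M` is faithful; (3) `N` is faithful; (4) every `θ_x` is a
monomorphism. -/
theorem faithful_tfae
    {C M' N' : Type*} [Category C] [Category M'] [Category N']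
    (I : M' ⥤ C) (M : C ⥤ M') (N : C ⥤ N') (J : N' ⥤ C)
    (adjN : N ⊣ J) (adjI : I ⊣ M) [I.Full] [I.Faithful] [J.Full] [J.Faithful]
    (hu : IsIso (adjI.comp adjN).unit) (hc : IsIso (adjI.comp adjN).counit)
    (h : ∀ x : C, Nonempty (IsInitial
      (StructuredArrow.mk (adjI.counit.app x ≫ adjN.unit.app x) :
        StructuredArrow (I.obj (M.obj x)) J))) :
    ((∀ x : C, Epi (adjI.counit.app x)) ↔ M.Faithful) ∧
      (M.Faithful ↔ N.Faithful) ∧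
      (N.Faithful ↔ ∀ x : C, Mono (adjN.unit.app x)) := by
  refine ⟨forall_epi_counit_iff_faithful adjI, ?_, faithful_iff_forall_mono_unit adjN⟩
  have hψ (x : C) : IsIso (N.map (adjI.counit.app x)) :=
    isIso_map_of_isInitial_mk_comp_unit adjN _ (h x).some
  let e : M ⋙ (I ⋙ N) ≅ N :=
    NatIso.ofComponents (fun x => asIso (N.map (adjI.counit.app x))) fun f =>
      (Functor.whiskerRight adjI.counit N).naturality f
  have hIN : (I ⋙ N).Faithful := (adjI.comp adjN).fullyFaithfulLOfIsIsoUnit.faithful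
  refine ⟨fun _ => Functor.Faithful.of_iso e, fun _ => ?_⟩
  have : (M ⋙ (I ⋙ N)).Faithful := Functor.Faithful.of_iso e.symm
  exact Functor.Faithful.of_comp M (I ⋙ N)
end
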